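/- (Chern character is a ring homomorphism) Let k be a field of characteristic zero. The map ch^g: K₀(g) → H^*(g,A) sending the class [W,∇] of a finite free g-connection to Σ_{n≥0} (1/n!)·[tr(R_∇^n)] is a well-defined ring homomorphism from the Grothendieck ring of g-connections (with addition induced by ⊕ and multiplication by ⊗_A) to the cohomology ring H^*(g,A); in particular ch^g(W⊕W') = ch^g(W) + ch^g(W') and ch^g(W⊗_A W') = ch^g(W)·ch^g(W'). -/

import Mathlib

open scoped TensorProduct BigOperators

structure LieRinehart (k A g : Type*) [CommRing k] [CommRing A] [Algebra k A]
    [LieRing g] [LieAlgebra k g] [Module A g] [IsScalarTower k A g] where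
  anchor : g → Module.End k A
  anchor_add : ∀ x y : g, anchor (x + y) = anchor x + anchor y
  anchor_smul : ∀ (a : A) (x : g) (b : A), anchor (a • x) b = a * anchor x b
  anchor_leibniz : ∀ (x : g) (a b : A), anchor x (a * b) = a * anchor x b + anchor x a * b
  anchor_bracket : ∀ x y : g, anchor ⁅x, y⁆ = ⁅anchor x, anchor y⁆
  bracket_smul : ∀ (a : A) (x y : g), ⁅x, a • y⁆ = a • ⁅x, y⁆ + anchor x a • y

variable {k A g : Type*} [Field k] [CharZero k] [CommRing A] [Algebra k A]
  [LieRing g] [LieAlgebra k g] [Module A g] [IsScalarTower k A g]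

structure LRConnection (L : LieRinehart k A g) (W : Type*) [AddCommGroup W]
    [Module k W] [Module A W] [IsScalarTower k A W] where
  conn : g → Module.End k W
  conn_add : ∀ x y : g, conn (x + y) = conn x + conn y
  conn_smul : ∀ (a : A) (x : g) (w : W), conn (a • x) w = a • conn x w
  leibniz : ∀ (x : g) (a : A) (w : W), conn x (a • w) = a • conn x w + L.anchor x a • w

variable {L : LieRinehart k A g}
variable {W W' : Type*} [AddCommGroup W] [Module k W] [Module A W] [IsScalarTower k A W]
  [AddCommGroup W'] [Module k W'] [Module A W'] [IsScalarTower k A W']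

/-- The curvature of a connection, as a `k`-linear endomorphism. -/
def curvK (D : LRConnection L W) (x y : g) : Module.End k W :=
  ⁅D.conn x, D.conn y⁆ - D.conn ⁅x, y⁆

/-- Remove the entries at positions `i < j` from a tuple. -/
def remove2 {n : ℕ} (v : Fin (n + 2) → g) (i j : Fin (n + 2)) (h : i < j) : Fin n → g :=
  fun m =>
    v (i.succAbove ((j.pred (by rintro rfl; exact absurd h (by simp))).succAbove m))

/-- The Lie–Rinehart (Chevalley–Eilenberg style) differential on cochains with values in a
module with connection. -/
noncomputable def lrD (D : LRConnection L W) {p : ℕ}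
    (ψ : (Fin (p + 1) → g) → W) : (Fin (p + 2) → g) → W := fun v =>
  (∑ i : Fin (p + 2), ((-1 : ℤ) ^ (i : ℕ)) • D.conn (v i) (ψ fun m => v (i.succAbove m)))
    + ∑ i : Fin (p + 2), ∑ j : Fin (p + 2),
        if h : i < j then
          ((-1 : ℤ) ^ ((i : ℕ) + (j : ℕ))) • ψ (Fin.cons ⁅v i, v j⁆ (remove2 v i j h))
        else 0

/-- The canonical connection on `A` itself, given by the anchor map. -/
def anchorConnection (L : LieRinehart k A g) : LRConnection L A where
  conn := L.anchor
  conn_add := L.anchor_add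
  conn_smul := fun a x w => by rw [L.anchor_smul, smul_eq_mul]
  leibniz := fun x a w => by
    simp only [smul_eq_mul]; rw [L.anchor_leibniz]

/-- The induced action `ad∇` of a connection on `End_A(W)`. -/
noncomputable def adAct (D : LRConnection L W) (x : g) (φ : W →ₗ[A] W) : W →ₗ[A] W where
  toFun w := D.conn x (φ w) - φ (D.conn x w)
  map_add' u v := by simp only [map_add]; abel
  map_smul' a w := by
    simp only [map_smul, RingHom.id_apply, D.leibniz, map_add, smul_sub]
    abel

/-- The Lie–Rinehart differential on `End_A(W)`-valued cochains, using `ad∇`. -/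
noncomputable def lrDEnd (D : LRConnection L W) {p : ℕ}
    (ψ : (Fin (p + 1) → g) → (W →ₗ[A] W)) : (Fin (p + 2) → g) → (W →ₗ[A] W) := fun v =>
  (∑ i : Fin (p + 2), ((-1 : ℤ) ^ (i : ℕ)) • adAct D (v i) (ψ fun m => v (i.succAbove m)))
    + ∑ i : Fin (p + 2), ∑ j : Fin (p + 2),
        if h : i < j then
          ((-1 : ℤ) ^ ((i : ℕ) + (j : ℕ))) • ψ (Fin.cons ⁅v i, v j⁆ (remove2 v i j h))
        else 0

/-- `σ` is a `(p,q)`-shuffle: strictly increasing on the first `p` and the last `q` positions. -/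
def IsShuffle (p q : ℕ) (σ : Equiv.Perm (Fin (p + q))) : Prop :=
  (∀ i j : Fin (p + q), i < j → (j : ℕ) < p → σ i < σ j) ∧
    (∀ i j : Fin (p + q), i < j → p ≤ (i : ℕ) → σ i < σ j)

open Classical in
/-- The exterior (shuffle) product of cochains, combined with a product `f` on values. -/
noncomputable def wedge {α β γ : Type*} [AddCommGroup γ] {p q : ℕ}
    (x : (Fin p → g) → α) (y : (Fin q → g) → β) (f : α → β → γ) :
    (Fin (p + q) → g) → γ := fun v =>
  ∑ σ : Equiv.Perm (Fin (p + q)),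
    if IsShuffle p q σ then
      ((Equiv.Perm.sign σ : ℤ)) •
        f (x fun i => v (σ (Fin.castAdd q i))) (y fun i => v (σ (Fin.natAdd p i)))
    else 0

/-- Wedge powers of an `End_A(W)`-valued `2`-cochain (e.g. the curvature); `powC R n = R^n`. -/
noncomputable def powC (R : (Fin 2 → g) → (W →ₗ[A] W)) :
    (n : ℕ) → (Fin (2 * n) → g) → (W →ₗ[A] W)
  | 0 => fun _ => LinearMap.id
  | n + 1 => wedge (powC R n) R fun f1 f2 => f1 ∘ₗ f2

/-- Reindexing a tuple along an equality of lengths. -/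
def recast {n m : ℕ} (h : n = m) (v : Fin m → g) : Fin n → g := fun i => v (Fin.cast h i)

/-- The `n`-th Chern character form `ch_n(W,∇) = (1/n!)·tr(R_∇^n)` as a `2n`-cochain. -/
noncomputable def chC [Algebra ℚ A] (R : (Fin 2 → g) → (W →ₗ[A] W)) (n : ℕ) :
    (Fin (2 * n) → g) → A :=
  fun v => ((n.factorial : ℚ)⁻¹) • LinearMap.trace A W (powC R n v)

set_option linter.unusedSectionVars false

section ShuffleSum

variable {X M N B C : Type*} [AddCommGroup M] [AddCommGroup N]

/-- The signed sum of `F a b` over all splittings of a list into complementary sublists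
`a` and `b`, the sign being that of the corresponding shuffle. -/
def shuffleSum : List X → (List X → List X → M) → M
  | [], F => F [] []
  | x :: l, F => shuffleSum l (fun a b => F (x :: a) b) +
      shuffleSum l (fun a b => (-1 : ℤ) ^ a.length • F a (x :: b))

theorem shuffleSum_add (l : List X) (F G : List X → List X → M) :
    shuffleSum l (fun a b => F a b + G a b) = shuffleSum l F + shuffleSum l G := by
  induction l generalizing F G with
  | nil => rfl
  | cons x l ih => simp only [shuffleSum, smul_add, ih]; abel

theorem map_shuffleSum (t : M →+ N) (l : List X) (F : List X → List X → M) :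
    t (shuffleSum l F) = shuffleSum l (fun a b => t (F a b)) := by
  induction l generalizing F with
  | nil => rfl
  | cons x l ih => simp only [shuffleSum, map_add, ih, map_zsmul]

theorem shuffleSum_zero (l : List X) : shuffleSum l (fun _ _ => (0 : M)) = 0 := by
  induction l with
  | nil => rfl
  | cons x l ih => simp only [shuffleSum, smul_zero, ih, add_zero]

theorem shuffleSum_eq_zero_of_length (l : List X) (F : List X → List X → M)
    (h : ∀ a b, a.length + b.length = l.length → F a b = 0) : shuffleSum l F = 0 := by
  induction l generalizing F with
  | nil => exact h [] [] rfl
  | cons x l ih =>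
    rw [shuffleSum, ih, ih, add_zero]
    · intro a b hab
      rw [h a (x :: b) (by simp only [List.length_cons]; omega), smul_zero]
    · intro a b hab
      exact h (x :: a) b (by simp only [List.length_cons]; omega)

theorem shuffleSum_swap (l : List X) (F : List X → List X → M) :
    shuffleSum l F = shuffleSum l (fun a b => (-1 : ℤ) ^ (a.length * b.length) • F b a) := by
  induction l generalizing F with
  | nil => simp [shuffleSum]
  | cons x l ih =>
    rw [shuffleSum, ih, ih (fun a b => (-1 : ℤ) ^ a.length • F a (x :: b)), shuffleSum, add_comm]
    congr 2
    · funext a b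
      rw [smul_smul, ← pow_add, List.length_cons]
      congr 2; ring
    · funext a b
      rw [smul_smul, List.length_cons, mul_add, mul_one, pow_add, mul_left_comm, ← mul_pow]
      simp

end ShuffleSum

/-- Cochains of all degrees at once: functions on lists of arguments. -/
def ListCochain (X B : Type*) := List X → B

namespace ListCochain

variable {X B C : Type*} [Ring B] [Ring C]

instance : AddCommGroup (ListCochain X B) := inferInstanceAs (AddCommGroup (List X → B))

instance : One (ListCochain X B) := ⟨fun l => if l = [] then 1 else 0⟩

instance : Mul (ListCochain X B) := ⟨fun ψ φ l => shuffleSum l fun a b => ψ a * φ b⟩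

@[ext] theorem ext {X B : Type*} {ψ φ : ListCochain X B} (h : ∀ l, ψ l = φ l) : ψ = φ := funext h

@[simp] theorem zero_apply (l : List X) : (0 : ListCochain X B) l = 0 := rfl

@[simp] theorem add_apply (ψ φ : ListCochain X B) (l : List X) : (ψ + φ) l = ψ l + φ l := rfl

@[simp] theorem neg_apply (ψ : ListCochain X B) (l : List X) : (-ψ) l = -ψ l := rfl

@[simp] theorem sub_apply (ψ φ : ListCochain X B) (l : List X) : (ψ - φ) l = ψ l - φ l := rfl

theorem mul_apply (ψ φ : ListCochain X B) (l : List X) :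
    (ψ * φ) l = shuffleSum l fun a b => ψ a * φ b := rfl

/-- Contraction of a cochain with a vector, put in the first slot. -/
def contract (x : X) (ψ : ListCochain X B) : ListCochain X B := fun l => ψ (x :: l)

/-- The grading involution. -/
def grade (ψ : ListCochain X B) : ListCochain X B := fun l => (-1 : ℤ) ^ l.length • ψ l

@[simp] theorem contract_apply {X B : Type*} (x : X) (ψ : ListCochain X B) (l : List X) :
    contract x ψ l = ψ (x :: l) := rfl

theorem grade_apply (ψ : ListCochain X B) (l : List X) :
    grade ψ l = (-1 : ℤ) ^ l.length • ψ l := rfl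

@[simp] theorem grade_nil (ψ : ListCochain X B) : grade ψ [] = ψ [] := by simp [grade_apply]

@[simp] theorem one_nil : (1 : ListCochain X B) [] = 1 := rfl

@[simp] theorem one_cons (x : X) (l : List X) : (1 : ListCochain X B) (x :: l) = 0 := rfl

@[simp] theorem contract_zero (x : X) : contract x (0 : ListCochain X B) = 0 := rfl

theorem contract_add (x : X) (ψ φ : ListCochain X B) :
    contract x (ψ + φ) = contract x ψ + contract x φ := rfl

@[simp] theorem contract_one (x : X) : contract x (1 : ListCochain X B) = 0 := rfl

@[simp] theorem grade_one : grade (1 : ListCochain X B) = 1 := by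
  ext l; cases l <;> simp [grade_apply]

theorem contract_grade (x : X) (ψ : ListCochain X B) :
    contract x (grade ψ) = -grade (contract x ψ) := by
  ext l
  simp [grade_apply, pow_succ]

theorem grade_add (ψ φ : ListCochain X B) : grade (ψ + φ) = grade ψ + grade φ := by
  ext l; simp [grade_apply]

@[simp] theorem mul_nil (ψ φ : ListCochain X B) : (ψ * φ) [] = ψ [] * φ [] := rfl

theorem contract_mul (x : X) (ψ φ : ListCochain X B) :
    contract x (ψ * φ) = contract x ψ * φ + grade ψ * contract x φ := by
  ext l
  simp only [add_apply, mul_apply, contract_apply, grade_apply, smul_mul_assoc]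
  rfl

theorem mul_cons (x : X) (l : List X) (ψ φ : ListCochain X B) :
    (ψ * φ) (x :: l) = (contract x ψ * φ) l + (grade ψ * contract x φ) l :=
  congrFun (contract_mul x ψ φ) l

theorem add_mul_aux (ψ φ χ : ListCochain X B) : (ψ + φ) * χ = ψ * χ + φ * χ := by
  ext l; simp only [mul_apply, add_apply, add_mul, shuffleSum_add]

theorem mul_add_aux (ψ φ χ : ListCochain X B) : ψ * (φ + χ) = ψ * φ + ψ * χ := by
  ext l; simp only [mul_apply, add_apply, mul_add, shuffleSum_add]

theorem zero_mul_aux (ψ : ListCochain X B) : 0 * ψ = 0 := by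
  ext l; simp only [mul_apply, zero_apply, zero_mul, shuffleSum_zero]

theorem mul_zero_aux (ψ : ListCochain X B) : ψ * 0 = 0 := by
  ext l; simp only [mul_apply, zero_apply, mul_zero, shuffleSum_zero]

theorem neg_mul_aux (ψ φ : ListCochain X B) : -ψ * φ = -(ψ * φ) := by
  rw [eq_neg_iff_add_eq_zero, ← add_mul_aux, neg_add_cancel, zero_mul_aux]

theorem grade_mul (ψ φ : ListCochain X B) : grade (ψ * φ) = grade ψ * grade φ := by
  ext l
  induction l generalizing ψ φ with
  | nil => simp
  | cons x l ih =>
    have h : ∀ χ : ListCochain X B, grade χ (x :: l) = -(grade (contract x χ) l) := fun χ =>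
      congrFun (contract_grade x χ) l
    rw [h, contract_mul, grade_add, add_apply, ih, ih, mul_cons, contract_grade, contract_grade,
      neg_mul_aux, neg_apply, neg_add, add_right_inj, ← neg_apply, ← neg_mul_aux]
    simp only [mul_apply, neg_apply, neg_mul, mul_neg]

theorem mul_assoc_aux (ψ φ χ : ListCochain X B) : ψ * φ * χ = ψ * (φ * χ) := by
  ext l
  induction l generalizing ψ φ χ with
  | nil => simp [mul_assoc]
  | cons x l ih =>
    simp only [mul_cons, contract_mul, grade_mul, add_mul_aux, mul_add_aux, add_apply, ih, add_assoc]

theorem one_mul_aux (ψ : ListCochain X B) : 1 * ψ = ψ := by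
  ext l
  induction l generalizing ψ with
  | nil => simp
  | cons x l ih => simp [mul_cons, zero_mul_aux, ih]

theorem mul_one_aux (ψ : ListCochain X B) : ψ * 1 = ψ := by
  ext l
  induction l generalizing ψ with
  | nil => simp
  | cons x l ih => simp [mul_cons, mul_zero_aux, ih]

instance : Ring (ListCochain X B) where
  __ := (inferInstance : AddCommGroup (ListCochain X B))
  left_distrib := mul_add_aux
  right_distrib := add_mul_aux
  zero_mul := zero_mul_aux
  mul_zero := mul_zero_aux
  mul_assoc := mul_assoc_aux
  one_mul := one_mul_aux
  mul_one := mul_one_aux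

theorem nsmul_apply (n : ℕ) (ψ : ListCochain X B) (l : List X) : (n • ψ) l = n • ψ l := by
  induction n with
  | zero => simp
  | succ n ih => rw [succ_nsmul, succ_nsmul, add_apply, ih]

theorem sum_apply {ι : Type*} (s : Finset ι) (ψ : ι → ListCochain X B) (l : List X) :
    (∑ i ∈ s, ψ i) l = ∑ i ∈ s, ψ i l := by
  induction s using Finset.cons_induction with
  | empty => simp
  | cons i s hi ih => rw [Finset.sum_cons, Finset.sum_cons, add_apply, ih]

/-- Applying a ring homomorphism to the values of cochains. -/
def map (f : B →+* C) : ListCochain X B →+* ListCochain X C where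
  toFun ψ l := f (ψ l)
  map_one' := by ext l; cases l <;> simp
  map_mul' ψ φ := by
    ext l
    refine (map_shuffleSum f.toAddMonoidHom l _).trans ?_
    simp only [RingHom.toAddMonoidHom_eq_coe, AddMonoidHom.coe_coe, map_mul]
    rfl
  map_zero' := by ext l; simp
  map_add' ψ φ := by ext l; exact map_add f (ψ l) (φ l)

@[simp] theorem map_apply (f : B →+* C) (ψ : ListCochain X B) (l : List X) :
    map f ψ l = f (ψ l) := rfl

/-- Applying an additive map to the values of cochains. -/
def mapAdd (t : B →+ C) (ψ : ListCochain X B) : ListCochain X C := fun l => t (ψ l)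

@[simp] theorem mapAdd_apply (t : B →+ C) (ψ : ListCochain X B) (l : List X) :
    mapAdd t ψ l = t (ψ l) := rfl

theorem contract_mapAdd (t : B →+ C) (x : X) (ψ : ListCochain X B) :
    contract x (mapAdd t ψ) = mapAdd t (contract x ψ) := rfl

/-- A cochain is homogeneous of degree `p` if it vanishes on lists of length other than `p`. -/
def IsHomogeneous (ψ : ListCochain X B) (p : ℕ) : Prop := ∀ l, l.length ≠ p → ψ l = 0

theorem IsHomogeneous.one : IsHomogeneous (1 : ListCochain X B) 0 := fun l hl => by
  cases l
  · exact absurd rfl hl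
  · rfl

theorem IsHomogeneous.mul {ψ φ : ListCochain X B} {p q : ℕ} (hψ : IsHomogeneous ψ p)
    (hφ : IsHomogeneous φ q) : IsHomogeneous (ψ * φ) (p + q) := fun l hl => by
  refine shuffleSum_eq_zero_of_length l _ fun a b hab => ?_
  by_cases ha : a.length = p
  · rw [hφ b (by omega), mul_zero]
  · rw [hψ a ha, zero_mul]

theorem IsHomogeneous.pow {ψ : ListCochain X B} {p : ℕ} (hψ : IsHomogeneous ψ p) (n : ℕ) :
    IsHomogeneous (ψ ^ n) (p * n) := by
  induction n with
  | zero => exact IsHomogeneous.one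
  | succ n ih => rw [pow_succ, mul_add, mul_one]; exact ih.mul hψ

theorem IsHomogeneous.map {ψ : ListCochain X B} {p : ℕ} (hψ : IsHomogeneous ψ p) (f : B →+* C) :
    IsHomogeneous (map f ψ) p := fun l hl => by rw [map_apply, hψ l hl, map_zero]

theorem commute_of_isHomogeneous_two {ψ φ : ListCochain X B} (hψ : IsHomogeneous ψ 2)
    (h : ∀ a b, Commute (ψ a) (φ b)) : Commute ψ φ := by
  ext l
  rw [mul_apply, mul_apply, shuffleSum_swap]
  congr 1
  funext a b
  by_cases hb : b.length = 2
  · rw [hb, mul_comm, pow_mul, neg_one_sq, one_pow, one_smul, (h b a).eq]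
  · rw [hψ b hb, zero_mul, mul_zero, smul_zero]

/-- Antisymmetry under exchange of adjacent arguments. -/
def IsAlt (ψ : ListCochain X B) : Prop :=
  ∀ (l₁ : List X) (x y : X) (l₂ : List X), ψ (l₁ ++ x :: y :: l₂) = -ψ (l₁ ++ y :: x :: l₂)

theorem IsAlt.contract {ψ : ListCochain X B} (hψ : IsAlt ψ) (x : X) : IsAlt (contract x ψ) :=
  fun l₁ => hψ (x :: l₁)

theorem IsAlt.one : IsAlt (1 : ListCochain X B) := fun l₁ x y l₂ => by
  cases l₁ <;> exact neg_zero.symm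

theorem IsAlt.grade {ψ : ListCochain X B} (hψ : IsAlt ψ) : IsAlt (grade ψ) := fun l₁ x y l₂ => by
  rw [grade_apply, grade_apply, hψ, smul_neg]; simp

theorem IsAlt.mul {ψ φ : ListCochain X B} (hψ : IsAlt ψ) (hφ : IsAlt φ) : IsAlt (ψ * φ) := by
  intro l₁
  induction l₁ generalizing ψ φ with
  | nil =>
    intro x y l₂
    have key : ∀ {χ : ListCochain X B}, IsAlt χ → ∀ x y,
        ListCochain.contract y (ListCochain.contract x χ) =
          -ListCochain.contract x (ListCochain.contract y χ) :=
      fun hχ x y => funext fun l => hχ [] x y l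
    suffices ListCochain.contract y (ListCochain.contract x (ψ * φ)) =
        -ListCochain.contract x (ListCochain.contract y (ψ * φ)) from congrFun this l₂
    simp only [contract_mul, contract_add, contract_grade, key hψ x y, key hφ x y, neg_mul, mul_neg]
    have hg : ∀ χ : ListCochain X B, ListCochain.grade (ListCochain.grade χ) = χ := fun χ => by
      ext l; rw [grade_apply, grade_apply, smul_smul, ← mul_pow]; simp
    rw [hg]
    abel
  | cons z l₁ ih =>
    intro x y l₂
    rw [List.cons_append, List.cons_append, mul_cons, mul_cons, ih (hψ.contract z) hφ,
      ih hψ.grade (hφ.contract z), neg_add]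

theorem IsAlt.pow {ψ : ListCochain X B} (hψ : IsAlt ψ) (n : ℕ) : IsAlt (ψ ^ n) := by
  induction n with
  | zero => exact IsAlt.one
  | succ n ih => rw [pow_succ]; exact ih.mul hψ

theorem IsAlt.mapAdd {ψ : ListCochain G B} (hψ : IsAlt ψ) (t : B →+ C) : IsAlt (mapAdd t ψ) :=
  fun l₁ x y l₂ => by rw [mapAdd_apply, mapAdd_apply, hψ, map_neg]

end ListCochain

namespace ListCochain

variable {G B C : Type*} [LieRing G] [Ring B] [Ring C]

def lieDerivAux (δ : B →+ B) (x : G) : List G → ListCochain G B → B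
  | [], ψ => δ (ψ [])
  | y :: l, ψ => lieDerivAux δ x l (contract y ψ) - ψ (⁅x, y⁆ :: l)

/-- The Lie derivative of a cochain along `x`, where `δ x` is the action of `x` on the
coefficients. -/
def lieDeriv (δ : G → B →+ B) (x : G) (ψ : ListCochain G B) : ListCochain G B :=
  fun l => lieDerivAux (δ x) x l ψ

def diffAux (δ : G → B →+ B) : List G → ListCochain G B → B
  | [], _ => 0
  | x :: l, ψ => lieDeriv δ x ψ l - diffAux δ l (contract x ψ)

/-- The differential on cochains, determined by Cartan's formula `ι_x d = L_x - d ι_x`. -/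
def diff (δ : G → B →+ B) (ψ : ListCochain G B) : ListCochain G B := fun l => diffAux δ l ψ

variable (δ : G → B →+ B)

@[simp] theorem lieDeriv_nil (x : G) (ψ : ListCochain G B) : lieDeriv δ x ψ [] = δ x (ψ []) := rfl

theorem lieDeriv_cons (x y : G) (l : List G) (ψ : ListCochain G B) :
    lieDeriv δ x ψ (y :: l) = lieDeriv δ x (contract y ψ) l - ψ (⁅x, y⁆ :: l) := rfl

theorem contract_lieDeriv (x y : G) (ψ : ListCochain G B) :
    contract y (lieDeriv δ x ψ) = lieDeriv δ x (contract y ψ) - contract ⁅x, y⁆ ψ := rfl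

@[simp] theorem diff_nil (ψ : ListCochain G B) : diff δ ψ [] = 0 := rfl

theorem diff_cons (x : G) (l : List G) (ψ : ListCochain G B) :
    diff δ ψ (x :: l) = lieDeriv δ x ψ l - diff δ (contract x ψ) l := rfl

theorem contract_diff (x : G) (ψ : ListCochain G B) :
    contract x (diff δ ψ) = lieDeriv δ x ψ - diff δ (contract x ψ) := rfl

theorem lieDeriv_add (x : G) (ψ φ : ListCochain G B) :
    lieDeriv δ x (ψ + φ) = lieDeriv δ x ψ + lieDeriv δ x φ := by
  ext l
  induction l generalizing ψ φ with
  | nil => simp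
  | cons y l ih =>
    rw [add_apply, lieDeriv_cons, contract_add, ih, lieDeriv_cons, lieDeriv_cons, add_apply,
      add_apply]
    abel

theorem diff_add (ψ φ : ListCochain G B) : diff δ (ψ + φ) = diff δ ψ + diff δ φ := by
  ext l
  induction l generalizing ψ φ with
  | nil => simp
  | cons y l ih =>
    rw [add_apply, diff_cons, contract_add, ih, diff_cons, diff_cons, lieDeriv_add, add_apply,
      add_apply]
    abel

theorem lieDeriv_zero (x : G) : lieDeriv δ x 0 = 0 := by
  simpa using lieDeriv_add δ x 0 0

theorem diff_zero : diff δ 0 = 0 := by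
  simpa using diff_add δ 0 0

theorem lieDeriv_neg (x : G) (ψ : ListCochain G B) : lieDeriv δ x (-ψ) = -lieDeriv δ x ψ := by
  rw [eq_neg_iff_add_eq_zero, ← lieDeriv_add, neg_add_cancel, lieDeriv_zero]

theorem diff_neg (ψ : ListCochain G B) : diff δ (-ψ) = -diff δ ψ := by
  rw [eq_neg_iff_add_eq_zero, ← diff_add, neg_add_cancel, diff_zero]

theorem grade_lieDeriv (x : G) (ψ : ListCochain G B) :
    grade (lieDeriv δ x ψ) = lieDeriv δ x (grade ψ) := by
  ext l
  induction l generalizing ψ with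
  | nil => simp
  | cons y l ih =>
    rw [lieDeriv_cons, contract_grade, lieDeriv_neg, neg_apply, ← ih, grade_apply, lieDeriv_cons,
      grade_apply, grade_apply, List.length_cons, List.length_cons, pow_succ]
    simp [mul_sub, neg_add_eq_sub]

theorem grade_diff (ψ : ListCochain G B) : grade (diff δ ψ) = -diff δ (grade ψ) := by
  ext l
  induction l generalizing ψ with
  | nil => simp
  | cons y l ih =>
    have h := ih (contract y ψ)
    rw [neg_apply] at h
    rw [neg_apply, diff_cons, contract_grade, diff_neg, neg_apply, ← h, ← grade_lieDeriv,
      grade_apply, diff_cons, grade_apply, grade_apply, List.length_cons, pow_succ]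
    simp [mul_sub]

variable {δ}

theorem lieDeriv_mul (hδ : ∀ x a b, δ x (a * b) = δ x a * b + a * δ x b) (x : G)
    (ψ φ : ListCochain G B) :
    lieDeriv δ x (ψ * φ) = lieDeriv δ x ψ * φ + ψ * lieDeriv δ x φ := by
  ext l
  induction l generalizing ψ φ with
  | nil => simp [hδ]
  | cons y l ih =>
    rw [add_apply, lieDeriv_cons, contract_mul, lieDeriv_add, add_apply, ih, ih, mul_cons, mul_cons,
      mul_cons, contract_lieDeriv, contract_lieDeriv, grade_lieDeriv, sub_mul, mul_sub]
    simp only [add_apply, sub_apply]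
    abel

/-- The differential is a graded derivation. -/
theorem diff_mul (hδ : ∀ x a b, δ x (a * b) = δ x a * b + a * δ x b) (ψ φ : ListCochain G B) :
    diff δ (ψ * φ) = diff δ ψ * φ + grade ψ * diff δ φ := by
  ext l
  induction l generalizing ψ φ with
  | nil => simp
  | cons x l ih =>
    have hg : grade (grade ψ) = ψ := by
      ext l; rw [grade_apply, grade_apply, smul_smul, ← mul_pow]; simp
    rw [add_apply, diff_cons, lieDeriv_mul hδ, contract_mul, diff_add, add_apply, add_apply, ih, ih,
      mul_cons, mul_cons, contract_diff, contract_diff, contract_grade, grade_diff, hg, sub_mul,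
      mul_sub, neg_mul, neg_mul]
    simp only [add_apply, sub_apply, neg_apply]
    abel

theorem diff_one (hδ : ∀ x a b, δ x (a * b) = δ x a * b + a * δ x b) :
    diff δ (1 : ListCochain G B) = 0 := by
  simpa using diff_mul hδ 1 1

theorem diff_pow_eq_zero (hδ : ∀ x a b, δ x (a * b) = δ x a * b + a * δ x b)
    {ψ : ListCochain G B} (hψ : diff δ ψ = 0) (n : ℕ) : diff δ (ψ ^ n) = 0 := by
  induction n with
  | zero => exact diff_one hδ
  | succ n ih => rw [pow_succ, diff_mul hδ, ih, hψ, zero_mul, mul_zero, add_zero]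

theorem lieDeriv_mapAdd {δ' : G → C →+ C} (t : B →+ C) (ht : ∀ x b, t (δ x b) = δ' x (t b))
    (x : G) (ψ : ListCochain G B) : lieDeriv δ' x (mapAdd t ψ) = mapAdd t (lieDeriv δ x ψ) := by
  ext l
  induction l generalizing ψ with
  | nil => exact (ht x _).symm
  | cons y l ih =>
    rw [lieDeriv_cons, contract_mapAdd, ih, mapAdd_apply, mapAdd_apply, mapAdd_apply, lieDeriv_cons,
      map_sub]

theorem diff_mapAdd {δ' : G → C →+ C} (t : B →+ C) (ht : ∀ x b, t (δ x b) = δ' x (t b))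
    (ψ : ListCochain G B) : diff δ' (mapAdd t ψ) = mapAdd t (diff δ ψ) := by
  ext l
  induction l generalizing ψ with
  | nil => exact (map_zero t).symm
  | cons y l ih =>
    rw [diff_cons, contract_mapAdd, ih, lieDeriv_mapAdd t ht, mapAdd_apply, mapAdd_apply,
      mapAdd_apply, diff_cons, map_sub]

theorem lieDeriv_eq_zero_of_length (x : G) (ψ : ListCochain G B) (l : List G)
    (h : ∀ m, m.length = l.length → ψ m = 0) : lieDeriv δ x ψ l = 0 := by
  induction l generalizing ψ with
  | nil => rw [lieDeriv_nil, h [] rfl, map_zero]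
  | cons y l ih =>
    rw [lieDeriv_cons, h (⁅x, y⁆ :: l) (by simp),
      ih (contract y ψ) fun m hm => h (y :: m) (by simp [hm]), sub_zero]

theorem diff_eq_zero_of_length (ψ : ListCochain G B) (l : List G)
    (h : ∀ m, m.length + 1 = l.length → ψ m = 0) : diff δ ψ l = 0 := by
  induction l generalizing ψ with
  | nil => rfl
  | cons y l ih =>
    rw [diff_cons, lieDeriv_eq_zero_of_length y ψ l fun m hm => h m (by simp [hm]),
      ih (contract y ψ) fun m hm => h (y :: m) (by simp [hm]), sub_zero]

theorem IsHomogeneous.diff_two_eq_zero {ψ : ListCochain G B} (hψ : IsHomogeneous ψ 2)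
    (h : ∀ x y z, δ x (ψ [y, z]) - ψ [⁅x, y⁆, z] - ψ [y, ⁅x, z⁆] - δ y (ψ [x, z]) +
      ψ [x, ⁅y, z⁆] + δ z (ψ [x, y]) = 0) : diff δ ψ = 0 := by
  ext l
  by_cases hl : l.length = 3
  · obtain ⟨x, y, z, rfl⟩ := List.length_eq_three.1 hl
    rw [zero_apply, ← h x y z]
    simp only [diff_cons, lieDeriv_cons, lieDeriv_nil, diff_nil, contract_apply]
    abel
  · exact diff_eq_zero_of_length ψ l fun m hm => hψ m (by omega)

open Finset in
theorem IsAlt.sum_bracket {ψ : ListCochain G B} (hψ : IsAlt ψ) (x : G) (l : List G) :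
    ∑ j ∈ range l.length, (-1 : ℤ) ^ (j + 1) • ψ (⁅x, l.getD j 0⁆ :: l.eraseIdx j) =
      lieDeriv δ x ψ l - δ x (ψ l) := by
  induction l generalizing ψ with
  | nil => simp
  | cons y l ih =>
    rw [List.length_cons, sum_range_succ', lieDeriv_cons]
    have h := ih (hψ.contract y)
    rw [eq_sub_iff_add_eq] at h
    rw [← h, contract_apply]
    have hs : ∑ j ∈ range l.length, (-1 : ℤ) ^ (j + 1 + 1) •
        ψ (⁅x, (y :: l).getD (j + 1) 0⁆ :: (y :: l).eraseIdx (j + 1)) =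
        ∑ j ∈ range l.length, (-1 : ℤ) ^ (j + 1) •
          ListCochain.contract y ψ (⁅x, l.getD j 0⁆ :: l.eraseIdx j) := by
      refine sum_congr rfl fun j _ => ?_
      have hj := hψ [] ⁅x, l.getD j 0⁆ y (l.eraseIdx j)
      simp only [List.nil_append] at hj
      rw [List.getD_cons_succ, List.eraseIdx_cons_succ, hj, pow_succ, contract_apply]
      simp
    rw [hs]
    simp
    abel

open Finset in
/-- The Chevalley–Eilenberg formula for the differential of an alternating cochain. -/
theorem IsAlt.diff_apply {ψ : ListCochain G B} (hψ : IsAlt ψ) (l : List G) :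
    diff δ ψ l = ∑ i ∈ range l.length, (-1 : ℤ) ^ i • δ (l.getD i 0) (ψ (l.eraseIdx i)) +
      ∑ i ∈ range l.length, ∑ j ∈ range l.length,
        if i < j then (-1 : ℤ) ^ (i + j) •
          ψ (⁅l.getD i 0, l.getD j 0⁆ :: (l.eraseIdx j).eraseIdx i) else 0 := by
  induction l generalizing ψ with
  | nil => simp
  | cons x l ih =>
    have hx := hψ.sum_bracket (δ := δ) x l
    rw [eq_sub_iff_add_eq] at hx
    have hpair : ∀ i j, ψ (⁅l.getD i 0, l.getD j 0⁆ :: x :: (l.eraseIdx j).eraseIdx i) =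
        -ListCochain.contract x ψ (⁅l.getD i 0, l.getD j 0⁆ :: (l.eraseIdx j).eraseIdx i) :=
      fun i j => hψ [] _ x _
    have hsign : ∀ i j, (-1 : ℤ) ^ (i + 1 + (j + 1)) = (-1) ^ (i + j) := fun i j => by ring
    rw [diff_cons, ih (hψ.contract x), ← hx, List.length_cons, sum_range_succ', sum_range_succ']
    simp only [sum_range_succ' _ l.length, List.getD_cons_succ, List.eraseIdx_cons_succ,
      List.getD_cons_zero, List.eraseIdx_cons_zero, add_lt_add_iff_right, not_lt_zero, if_false,
      add_zero, zero_add, Nat.succ_pos, if_true, lt_irrefl, hpair, hsign, smul_neg, pow_succ,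
      mul_neg_one, neg_smul, pow_zero, one_smul, contract_apply, sum_neg_distrib]
    have hite : ∀ (P : Prop) [Decidable P] (b : B),
        (if P then -b else 0) = -if P then b else 0 := fun P _ b => by split <;> simp
    simp only [hite, sum_neg_distrib]
    abel

end ListCochain

section Permutations

open Equiv

/-- The permutation sending `i` to `0` and acting on the complement of `i` as `e`. -/
def permOfZero {n : ℕ} (i : Fin (n + 1)) (e : Perm (Fin n)) : Perm (Fin (n + 1)) :=
  Perm.decomposeFin.symm (0, e) * i.cycleRange

@[simp] theorem permOfZero_self {n : ℕ} (i : Fin (n + 1)) (e : Perm (Fin n)) :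
    permOfZero i e i = 0 := by
  simp [permOfZero]

@[simp] theorem permOfZero_succAbove {n : ℕ} (i : Fin (n + 1)) (e : Perm (Fin n)) (j : Fin n) :
    permOfZero i e (i.succAbove j) = (e j).succ := by
  simp [permOfZero]

theorem sign_permOfZero {n : ℕ} (i : Fin (n + 1)) (e : Perm (Fin n)) :
    Perm.sign (permOfZero i e) = (-1) ^ (i : ℕ) * Perm.sign e := by
  simp [permOfZero, Perm.decomposeFin.symm_sign, mul_comm]

theorem sum_perm_succ {M : Type*} [AddCommMonoid M] {n : ℕ} (f : Perm (Fin (n + 1)) → M) :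
    ∑ σ, f σ = ∑ i, ∑ e, f (permOfZero i e) := by
  rw [← Fintype.sum_prod_type']
  refine (Function.Bijective.sum_comp (g := f)
    (e := fun x : Fin (n + 1) × Perm (Fin n) => permOfZero x.1 x.2) ?_).symm
  rw [Fintype.bijective_iff_injective_and_card]
  constructor
  · rintro ⟨i, e⟩ ⟨j, e'⟩ h
    simp only at h
    obtain rfl : i = j := (permOfZero i e).injective (by rw [permOfZero_self, h, permOfZero_self])
    refine Prod.ext rfl (Equiv.ext fun m => Fin.succ_injective _ ?_)
    rw [← permOfZero_succAbove i, ← permOfZero_succAbove i, h]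
  · simp [Fintype.card_perm, Nat.factorial_succ]

/-- A permutation of `Fin n` increasing on the first `p` and on the last `n - p` positions. -/
def IsShufflePerm {n : ℕ} (p : ℕ) (σ : Perm (Fin n)) : Prop :=
  (∀ i j : Fin n, i < j → (j : ℕ) < p → σ i < σ j) ∧
    (∀ i j : Fin n, i < j → p ≤ (i : ℕ) → σ i < σ j)

theorem isShufflePerm_permOfZero_zero {n p : ℕ} (e : Perm (Fin n)) :
    IsShufflePerm (p + 1) (permOfZero 0 e) ↔ IsShufflePerm p e := by
  have h : ∀ j : Fin n, permOfZero 0 e j.succ = (e j).succ := fun j => by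
    rw [← Fin.succAbove_zero_apply, permOfZero_succAbove]
  constructor
  · rintro ⟨h₁, h₂⟩
    refine ⟨fun i j hij hj => ?_, fun i j hij hi => ?_⟩
    · simpa [h] using h₁ i.succ j.succ (by simpa) (by simpa)
    · simpa [h] using h₂ i.succ j.succ (by simpa) (by simpa)
  · rintro ⟨h₁, h₂⟩
    refine ⟨fun i j hij hj => ?_, fun i j hij hi => ?_⟩
    · cases j using Fin.cases with
      | zero => simp at hij
      | succ j =>
        cases i using Fin.cases with
        | zero => simp [h]
        | succ i => simpa [h] using h₁ i j (by simpa using hij) (by simpa using hj)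
    · cases j using Fin.cases with
      | zero => simp at hij
      | succ j =>
        cases i using Fin.cases with
        | zero => simp at hi
        | succ i => simpa [h] using h₂ i j (by simpa using hij) (by simpa using hi)

theorem isShufflePerm_permOfZero {n : ℕ} (i : Fin (n + 1)) (e : Perm (Fin n)) :
    IsShufflePerm (i : ℕ) (permOfZero i e) ↔ IsShufflePerm (i : ℕ) e := by
  have hval : ∀ j : Fin n, (i.succAbove j : ℕ) = if (j : ℕ) < i then (j : ℕ) else j + 1 :=
    fun j => by simp only [Fin.succAbove, Fin.lt_def, Fin.val_castSucc]; split <;> rfl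
  constructor
  · rintro ⟨h₁, h₂⟩
    refine ⟨fun a b hab hb => ?_, fun a b hab ha => ?_⟩
    · have := h₁ (i.succAbove a) (i.succAbove b) (Fin.succAbove_lt_succAbove_iff.2 hab)
        (by rw [hval, if_pos hb]; exact hb)
      simpa using this
    · have := h₂ (i.succAbove a) (i.succAbove b) (Fin.succAbove_lt_succAbove_iff.2 hab)
        (by rw [hval, if_neg (by omega)]; omega)
      simpa using this
  · rintro ⟨h₁, h₂⟩
    refine ⟨fun a b hab hb => ?_, fun a b hab ha => ?_⟩
    · obtain ⟨b, rfl⟩ := Fin.exists_succAbove_eq (x := b) (y := i) (by rintro rfl; omega)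
      obtain ⟨a, rfl⟩ := Fin.exists_succAbove_eq (x := a) (y := i)
        (by rintro rfl; have := Fin.lt_def.1 hab; omega)
      have hb' := hval b
      have := h₁ a b (Fin.succAbove_lt_succAbove_iff.1 hab) (by split at hb' <;> omega)
      simpa using this
    · obtain ⟨b, rfl⟩ := Fin.exists_succAbove_eq (x := b) (y := i)
        (by rintro rfl; have := Fin.lt_def.1 hab; omega)
      by_cases hai : a = i
      · rw [hai]; simp
      · obtain ⟨a, rfl⟩ := Fin.exists_succAbove_eq hai
        have ha' := hval a
        have := h₂ a b (Fin.succAbove_lt_succAbove_iff.1 hab) (by split at ha' <;> omega)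
        simpa using this

theorem not_isShufflePerm_permOfZero {n p : ℕ} {i : Fin (n + 1)} (e : Perm (Fin n))
    (h0 : i = 0 → p = 0) (hp : (i : ℕ) ≠ p) : ¬ IsShufflePerm p (permOfZero i e) := by
  rintro ⟨h₁, h₂⟩
  rcases lt_or_gt_of_ne hp with h | h
  · have hi : i ≠ 0 := fun hi => by have := h0 hi; omega
    have := h₁ 0 i (Fin.pos_iff_ne_zero.2 hi) h
    simp at this
  · have := h₂ ⟨p, by omega⟩ i h le_rfl
    simp at this

theorem take_ofFn_succAbove {X : Type*} {n : ℕ} (u : Fin (n + 1) → X) (i : Fin (n + 1)) :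
    (List.ofFn u).take i = (List.ofFn fun j => u (i.succAbove j)).take i := by
  refine List.ext_getElem (by simp; omega) fun m h₁ h₂ => ?_
  simp only [List.length_take, List.length_ofFn, lt_inf_iff] at h₁ h₂
  simp [Fin.succAbove, Fin.lt_def, h₁.1, -List.ofFn_succ]

theorem drop_ofFn_succAbove {X : Type*} {n : ℕ} (u : Fin (n + 1) → X) (i : Fin (n + 1)) :
    (List.ofFn u).drop i = u i :: (List.ofFn fun j => u (i.succAbove j)).drop i := by
  refine List.ext_getElem (by simp; omega) fun m h₁ h₂ => ?_
  cases m with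
  | zero => simp [-List.ofFn_succ]
  | succ m => simp [Fin.succAbove, Fin.lt_def, add_assoc, -List.ofFn_succ]

open Classical in
theorem sum_isShufflePerm {X M : Type*} [AddCommGroup M] {n : ℕ} (p : ℕ) (v : Fin n → X)
    (F : List X → List X → M) (hF : ∀ a b, a.length ≠ p → F a b = 0) :
    (∑ σ : Perm (Fin n), if IsShufflePerm p σ then (Perm.sign σ : ℤ) •
      F ((List.ofFn fun i => v (σ i)).take p) ((List.ofFn fun i => v (σ i)).drop p) else 0) =
      shuffleSum (List.ofFn v) F := by
  induction n generalizing p F with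
  | zero =>
    have h : IsShufflePerm p (1 : Perm (Fin 0)) := ⟨fun i => i.elim0, fun i => i.elim0⟩
    simp [shuffleSum, h, Subsingleton.elim (default : Perm (Fin 0)) 1]
  | succ n ih =>
    set l := List.ofFn fun i : Fin n => v i.succ with hl
    set F₁ : List X → List X → M := fun a b => F (v 0 :: a) b with hF₁
    set F₂ : List X → List X → M := fun a b => (-1 : ℤ) ^ a.length • F a (v 0 :: b) with hF₂
    have key : ∀ i : Fin (n + 1), (∑ e : Perm (Fin n), if IsShufflePerm p (permOfZero i e) then
        (Perm.sign (permOfZero i e) : ℤ) •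
          F ((List.ofFn fun j => v (permOfZero i e j)).take p)
            ((List.ofFn fun j => v (permOfZero i e j)).drop p) else 0) =
        (if i = 0 then shuffleSum l F₁ else 0) + if (i : ℕ) = p then shuffleSum l F₂ else 0 := by
      intro i
      have hz : p = 0 → shuffleSum l F₁ = 0 := fun hp =>
        shuffleSum_eq_zero_of_length _ _ fun a b _ => hF _ _ (by simp [hp])
      by_cases hip : (i : ℕ) = p
      · have h0 : (if i = 0 then shuffleSum l F₁ else 0) = 0 := by
          split_ifs with h
          · exact hz (by rw [← hip, h]; rfl)
          · rfl
        subst hip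
        rw [h0, zero_add, if_pos rfl,
          ← ih (i : ℕ) (fun j => v j.succ) F₂ fun a b hab => by simp [hF₂, hF a _ hab]]
        refine Finset.sum_congr rfl fun e _ => ?_
        rw [take_ofFn_succAbove, drop_ofFn_succAbove, sign_permOfZero]
        simp only [isShufflePerm_permOfZero, permOfZero_succAbove, permOfZero_self, hF₂,
          List.length_take, List.length_ofFn, min_eq_left (Nat.lt_succ_iff.1 i.2), smul_smul]
        congr 2
        push_cast
        ring
      · rw [if_neg hip, add_zero]
        by_cases hi : i = 0 ∧ p ≠ 0
        · obtain ⟨rfl, hp⟩ := hi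
          obtain ⟨p, rfl⟩ := Nat.exists_eq_succ_of_ne_zero hp
          rw [if_pos rfl, ← ih p (fun j => v j.succ) F₁ fun a b hab => hF _ _ (by simpa using hab)]
          refine Finset.sum_congr rfl fun e _ => ?_
          have h : ∀ j : Fin n, permOfZero 0 e j.succ = (e j).succ := fun j => by
            rw [← Fin.succAbove_zero_apply, permOfZero_succAbove]
          simp [isShufflePerm_permOfZero_zero, sign_permOfZero, List.ofFn_succ, h, hF₁]
        · rw [Finset.sum_eq_zero fun e _ => if_neg (not_isShufflePerm_permOfZero e
            (fun h => by by_contra hp; exact hi ⟨h, hp⟩) hip)]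
          split_ifs with h
          · exact (hz (by by_contra hp; exact hi ⟨h, hp⟩)).symm
          · rfl
    rw [sum_perm_succ, Finset.sum_congr rfl fun i _ => key i, Finset.sum_add_distrib,
      List.ofFn_succ, shuffleSum]
    congr 1
    · simp [hF₁, hl]
    · by_cases hp : p < n + 1
      · rw [Finset.sum_eq_single (⟨p, hp⟩ : Fin (n + 1))]
        · simp [hF₂, hl]
        · intro i _ hi
          exact if_neg fun h => hi (Fin.ext h)
        · simp
      · rw [Finset.sum_eq_zero fun i _ => if_neg (by omega), shuffleSum_eq_zero_of_length]
        intro a b hab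
        rw [hF a _ (by simp at hab; omega), smul_zero]

end Permutations

theorem wedge_eq_shuffleSum {X α β γ : Type*} [LieRing X] [AddCommGroup γ] {p q : ℕ}
    {x : (Fin p → X) → α} {y : (Fin q → X) → β} {f : α → β → γ} {F : List X → List X → γ}
    (hF : ∀ u w, F (List.ofFn u) (List.ofFn w) = f (x u) (y w))
    (hF₀ : ∀ a b, a.length ≠ p → F a b = 0) (v : Fin (p + q) → X) :
    wedge x y f v = shuffleSum (List.ofFn v) F := by
  rw [← sum_isShufflePerm p v F hF₀]
  refine Finset.sum_congr rfl fun σ _ => ?_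
  have h : (List.ofFn fun i => v (σ i)) = (List.ofFn fun i => v (σ (Fin.castAdd q i))) ++
      List.ofFn fun i => v (σ (Fin.natAdd p i)) := List.ofFn_add
  rw [h, List.take_left' (by simp), List.drop_left' (by simp), hF]
  rfl

namespace ListCochain

/-- The homogeneous cochain of degree two with the given values on pairs. -/
def ofPair {X B : Type*} [Zero B] (R : (Fin 2 → X) → B) : ListCochain X B
  | [x, y] => R ![x, y]
  | _ => 0

@[simp] theorem ofPair_pair {X B : Type*} [Zero B] (R : (Fin 2 → X) → B) (x y : X) :
    ofPair R [x, y] = R ![x, y] := rfl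

theorem ofPair_eq_zero {X B : Type*} [Zero B] (R : (Fin 2 → X) → B) {l : List X}
    (hl : l.length ≠ 2) : ofPair R l = 0 := by
  rcases l with _ | ⟨x, _ | ⟨y, _ | ⟨z, l⟩⟩⟩
  · rfl
  · rfl
  · exact absurd rfl hl
  · rfl

theorem ofPair_ofFn {X B : Type*} [Zero B] (R : (Fin 2 → X) → B) (u : Fin 2 → X) :
    ofPair R (List.ofFn u) = R u := by
  have h : List.ofFn u = [u 0, u 1] := by simp [List.ofFn_succ]
  have hu : ![u 0, u 1] = u := by
    funext i; fin_cases i <;> rfl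
  rw [h, ofPair_pair, hu]

theorem isHomogeneous_ofPair {X B : Type*} [Ring B] (R : (Fin 2 → X) → B) :
    IsHomogeneous (ofPair R) 2 := fun _ hl => ofPair_eq_zero R hl

theorem isAlt_ofPair {X B : Type*} [Ring B] {R : (Fin 2 → X) → B}
    (h : ∀ x y, R ![x, y] = -R ![y, x]) : IsAlt (ofPair R) := by
  intro l₁ x y l₂
  by_cases hl : (l₁ ++ x :: y :: l₂).length = 2
  · have h₁ : l₁ = [] := List.eq_nil_of_length_eq_zero (by simp at hl; omega)
    have h₂ : l₂ = [] := List.eq_nil_of_length_eq_zero (by simp at hl; omega)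
    subst h₁ h₂
    exact h x y
  · rw [ofPair_eq_zero R hl, ofPair_eq_zero R (by simpa using hl), neg_zero]

theorem map_ofPair {X B C : Type*} [Ring B] [Ring C] (f : B →+* C) (R : (Fin 2 → X) → B) :
    map f (ofPair R) = ofPair fun u => f (R u) := by
  ext l
  by_cases hl : l.length = 2
  · obtain ⟨x, y, rfl⟩ := List.length_eq_two.1 hl
    rfl
  · rw [map_apply, ofPair_eq_zero _ hl, ofPair_eq_zero _ hl, map_zero]

end ListCochain

open ListCochain

theorem powC_eq_pow (R : (Fin 2 → g) → (W →ₗ[A] W)) (n : ℕ) (v : Fin (2 * n) → g) :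
    powC R n v = (ofPair (B := Module.End A W) R ^ n) (List.ofFn v) := by
  induction n with
  | zero => rfl
  | succ n ih =>
    have h := wedge_eq_shuffleSum (x := powC R n) (y := R) (f := fun f₁ f₂ => f₁ ∘ₗ f₂)
      (F := fun a b => (ofPair (B := Module.End A W) R ^ n) a * ofPair (B := Module.End A W) R b)
      (fun u w => by rw [← ih, ofPair_ofFn]; rfl)
      (fun a b ha => by rw [(isHomogeneous_ofPair R).pow n a ha, zero_mul]) v
    rw [pow_succ]
    exact h

theorem ofFn_recast {n m : ℕ} (h : n = m) (v : Fin m → g) :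
    List.ofFn (recast h v) = List.ofFn v := by
  subst h; rfl

theorem powC_prodMap {R : (Fin 2 → g) → (W →ₗ[A] W)} {R' : (Fin 2 → g) → (W' →ₗ[A] W')}
    {RS : (Fin 2 → g) → (W × W' →ₗ[A] W × W')} (h : ∀ u, RS u = (R u).prodMap (R' u))
    (n : ℕ) (v : Fin (2 * n) → g) :
    powC RS n v = (powC R n v).prodMap (powC R' n v) := by
  obtain rfl : RS = fun u => (R u).prodMap (R' u) := funext h
  have key := map_ofPair (LinearMap.prodMapRingHom A W W') fun u => (R u, R' u)
  have hfst := map_ofPair (RingHom.fst (Module.End A W) (Module.End A W')) fun u => (R u, R' u)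
  have hsnd := map_ofPair (RingHom.snd (Module.End A W) (Module.End A W')) fun u => (R u, R' u)
  simp only [LinearMap.prodMapRingHom_apply, RingHom.coe_fst, RingHom.coe_snd] at key hfst hsnd
  rw [powC_eq_pow, powC_eq_pow, powC_eq_pow, ← hfst, ← hsnd, ← map_pow, ← map_pow]
  refine (congrArg (fun ψ => (ψ ^ n) (List.ofFn v)) key.symm).trans ?_
  simp only [← map_pow]
  rfl

theorem curvK_apply (D : LRConnection L W) (x y : g) (w : W) :
    curvK D x y w = D.conn x (D.conn y w) - D.conn y (D.conn x w) - D.conn ⁅x, y⁆ w := rfl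

theorem LRConnection.conn_neg (D : LRConnection L W) (x : g) : D.conn (-x) = -D.conn x :=
  map_neg (AddMonoidHom.mk' D.conn D.conn_add) x

theorem isAlt_curvature {D : LRConnection L W} {R : (Fin 2 → g) → (W →ₗ[A] W)}
    (hR : ∀ (u : Fin 2 → g) (w : W), R u w = curvK D (u 0) (u 1) w) :
    IsAlt (ofPair (B := Module.End A W) R) := by
  refine isAlt_ofPair fun x y => LinearMap.ext fun w => ?_
  have h : D.conn ⁅x, y⁆ w = -D.conn ⁅y, x⁆ w := by
    rw [← lie_skew, D.conn_neg]; rfl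
  rw [LinearMap.neg_apply, hR, hR, curvK_apply, curvK_apply]
  simp only [Matrix.cons_val_zero, Matrix.cons_val_one, h]
  abel

/-- The action `ad∇` along a fixed vector, as an additive map. -/
noncomputable def adHom (D : LRConnection L W) (x : g) : Module.End A W →+ Module.End A W :=
  AddMonoidHom.mk' (adAct D x) fun φ χ => LinearMap.ext fun w => by
    simp only [adAct, LinearMap.coe_mk, AddHom.coe_mk, LinearMap.add_apply, map_add]
    abel

theorem adHom_apply (D : LRConnection L W) (x : g) (φ : Module.End A W) (w : W) :
    adHom D x φ w = D.conn x (φ w) - φ (D.conn x w) := rfl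

theorem adHom_mul (D : LRConnection L W) (x : g) (φ χ : Module.End A W) :
    adHom D x (φ * χ) = adHom D x φ * χ + φ * adHom D x χ := by
  ext w
  simp only [LinearMap.add_apply, Module.End.mul_apply, adHom_apply, map_sub]
  abel

/-- The Bianchi identity. -/
theorem bianchi {D : LRConnection L W} {R : (Fin 2 → g) → (W →ₗ[A] W)}
    (hR : ∀ (u : Fin 2 → g) (w : W), R u w = curvK D (u 0) (u 1) w) :
    diff (adHom D) (ofPair (B := Module.End A W) R) = 0 := by
  refine (isHomogeneous_ofPair R).diff_two_eq_zero fun x y z => LinearMap.ext fun w => ?_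
  have h : D.conn ⁅x, ⁅y, z⁆⁆ w = D.conn ⁅⁅x, y⁆, z⁆ w + D.conn ⁅y, ⁅x, z⁆⁆ w := by
    rw [leibniz_lie x y z, D.conn_add]; rfl
  simp only [ofPair_pair, LinearMap.add_apply, LinearMap.sub_apply, adHom_apply, hR, curvK_apply,
    Matrix.cons_val_zero, Matrix.cons_val_one, map_sub, h, LinearMap.zero_apply]
  abel

theorem trace_adHom [Module.Finite A W] [Module.Free A W] (D : LRConnection L W) (x : g)
    (φ : Module.End A W) :
    LinearMap.trace A W (adHom D x φ) = L.anchor x (LinearMap.trace A W φ) := by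
  let b := Module.Free.chooseBasis A W
  let Γ : Module.End A W := b.constr A fun i => D.conn x (b i)
  have hΓ : ∀ i, Γ (b i) = D.conn x (b i) := fun i => b.constr_basis A _ i
  have hconn : ∀ w, D.conn x w = Γ w + ∑ i, L.anchor x (b.repr w i) • b i := fun w => by
    conv_lhs => rw [← b.sum_repr w]
    conv_rhs => enter [1]; rw [← b.sum_repr w]
    simp only [map_sum, map_smul, D.leibniz, hΓ, Finset.sum_add_distrib]
  have htr : ∀ χ : Module.End A W, LinearMap.trace A W χ = ∑ i, b.repr (χ (b i)) i := fun χ => by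
    rw [LinearMap.trace_eq_matrix_trace A b]
    simp [Matrix.trace, LinearMap.toMatrix_apply]
  have hcoord : ∀ i, b.repr (adHom D x φ (b i)) i =
      b.repr ((Γ * φ - φ * Γ) (b i)) i + L.anchor x (b.repr (φ (b i)) i) := fun i => by
    rw [adHom_apply, ← hΓ, hconn]
    simp [Finsupp.single_apply]
    ring
  rw [htr, Finset.sum_congr rfl fun i _ => hcoord i, Finset.sum_add_distrib, ← htr, htr φ, map_sum,
    map_sub, LinearMap.trace_mul_comm, sub_self, zero_add]

theorem ofFn_comp_succAbove {X : Type*} {n : ℕ} (v : Fin (n + 1) → X) (i : Fin (n + 1)) :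
    (List.ofFn fun m => v (i.succAbove m)) = (List.ofFn v).eraseIdx i := by
  rw [List.eraseIdx_eq_take_drop_succ, take_ofFn_succAbove, ← List.tail_drop, drop_ofFn_succAbove,
    List.tail_cons, List.take_append_drop]

theorem eraseIdx_succ_eraseIdx {X : Type*} (l : List X) {i j : ℕ} (h : i ≤ j) :
    (l.eraseIdx (j + 1)).eraseIdx i = (l.eraseIdx i).eraseIdx j := by
  induction l generalizing i j with
  | nil => rfl
  | cons x l ih =>
    cases i with
    | zero => rfl
    | succ i =>
      obtain ⟨j, rfl⟩ := Nat.exists_eq_succ_of_ne_zero (show j ≠ 0 by omega)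
      simp [ih (show i ≤ j by omega)]

theorem ofFn_remove2 {X : Type*} [LieRing X] {n : ℕ} (v : Fin (n + 2) → X) (i j : Fin (n + 2))
    (h : i < j) : List.ofFn (remove2 v i j h) = ((List.ofFn v).eraseIdx j).eraseIdx i := by
  obtain ⟨j, rfl⟩ := Fin.exists_succ_eq.2 (Fin.ne_zero_of_lt h)
  refine (ofFn_comp_succAbove (fun m => v (i.succAbove m)) _).trans ?_
  rw [ofFn_comp_succAbove, Fin.pred_succ, Fin.val_succ,
    eraseIdx_succ_eraseIdx _ (Nat.lt_succ_iff.1 (Fin.lt_def.1 h))]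

theorem lrD_anchor_ofFn {ψ : ListCochain g A} (hψ : IsAlt ψ) {p : ℕ} (v : Fin (p + 2) → g) :
    lrD (anchorConnection L) (fun u : Fin (p + 1) → g => ψ (List.ofFn u)) v =
      diff (fun x => (L.anchor x).toAddMonoidHom) ψ (List.ofFn v) := by
  have hget : ∀ i : Fin (p + 2), (List.ofFn v).getD i 0 = v i := fun i => by
    simp [List.getD_eq_getElem?_getD, -List.ofFn_succ]
  rw [hψ.diff_apply, List.length_ofFn, lrD]
  simp only [Finset.sum_range, hget]
  congr 1
  · refine Finset.sum_congr rfl fun i _ => ?_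
    rw [ofFn_comp_succAbove]
    rfl
  · refine Finset.sum_congr rfl fun i _ => Finset.sum_congr rfl fun j _ => ?_
    by_cases h : i < j
    · rw [dif_pos h, if_pos (Fin.lt_def.1 h), List.ofFn_cons, ofFn_remove2]
    · rw [dif_neg h, if_neg (mt Fin.lt_def.2 h)]

theorem curvature_tensor {D : LRConnection L W} {D' : LRConnection L W'}
    {T : LRConnection L (W ⊗[A] W')}
    (hT : ∀ (z : g) (w : W) (w' : W'),
      T.conn z (w ⊗ₜ[A] w') = D.conn z w ⊗ₜ[A] w' + w ⊗ₜ[A] D'.conn z w')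
    {R : (Fin 2 → g) → (W →ₗ[A] W)} {R' : (Fin 2 → g) → (W' →ₗ[A] W')}
    {RT : (Fin 2 → g) → (W ⊗[A] W' →ₗ[A] W ⊗[A] W')}
    (hR : ∀ (u : Fin 2 → g) (w : W), R u w = curvK D (u 0) (u 1) w)
    (hR' : ∀ (u : Fin 2 → g) (w' : W'), R' u w' = curvK D' (u 0) (u 1) w')
    (hRT : ∀ (u : Fin 2 → g) (z : W ⊗[A] W'), RT u z = curvK T (u 0) (u 1) z) (u : Fin 2 → g) :
    RT u = (R u).rTensor W' + (R' u).lTensor W := by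
  refine TensorProduct.ext' fun w w' => ?_
  simp only [LinearMap.add_apply, LinearMap.rTensor_tmul, LinearMap.lTensor_tmul, hRT, hR, hR',
    curvK_apply, hT, map_add, TensorProduct.sub_tmul, TensorProduct.tmul_sub]
  abel

/-- The trace of a power of the sum of two commuting tensor factors. -/
theorem trace_pow_tensor {X : Type*} [Module.Finite A W] [Module.Free A W] [Module.Finite A W']
    [Module.Free A W'] {ψ : ListCochain X (Module.End A W)} {φ : ListCochain X (Module.End A W')}
    {χ : ListCochain X (Module.End A (W ⊗[A] W'))} (hψ : IsHomogeneous ψ 2)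
    (hχ : ∀ l, χ l = (ψ l).rTensor W' + (φ l).lTensor W) (n : ℕ) (l : List X) :
    LinearMap.trace A _ ((χ ^ n) l) = ∑ i ∈ Finset.range (n + 1), n.choose i •
      shuffleSum l fun a b =>
        LinearMap.trace A W ((ψ ^ i) a) * LinearMap.trace A W' ((φ ^ (n - i)) b) := by
  let r := (Module.End.rTensorAlgHom A W W').toRingHom
  let s := (Module.End.lTensorAlgHom A W' W).toRingHom
  have h : χ = map r ψ + map s φ := ListCochain.ext hχ
  have hcomm : Commute (map r ψ) (map s φ) :=
    commute_of_isHomogeneous_two (hψ.map r) fun a b =>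
      (LinearMap.rTensor_comp_lTensor _ _ _).trans (LinearMap.lTensor_comp_rTensor _ _ _).symm
  rw [h, hcomm.add_pow, ListCochain.sum_apply, map_sum]
  refine Finset.sum_congr rfl fun i _ => ?_
  rw [← nsmul_eq_mul', nsmul_apply, map_nsmul, ← map_pow, ← map_pow, mul_apply]
  congr 1
  refine (map_shuffleSum (LinearMap.trace A (W ⊗[A] W')).toAddMonoidHom l _).trans ?_
  congr 1
  funext a b
  rw [← LinearMap.trace_tensorProduct', ← LinearMap.rTensor_comp_lTensor]
  rfl

theorem ofPair_tensor {X : Type*} {R : (Fin 2 → X) → (W →ₗ[A] W)}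
    {R' : (Fin 2 → X) → (W' →ₗ[A] W')}
    {RT : (Fin 2 → X) → (W ⊗[A] W' →ₗ[A] W ⊗[A] W')}
    (h : ∀ u, RT u = (R u).rTensor W' + (R' u).lTensor W) (l : List X) :
    ofPair (B := Module.End A (W ⊗[A] W')) RT l =
      (ofPair (B := Module.End A W) R l).rTensor W' +
        (ofPair (B := Module.End A W') R' l).lTensor W := by
  by_cases hl : l.length = 2
  · obtain ⟨x, y, rfl⟩ := List.length_eq_two.1 hl
    exact h _
  · rw [ofPair_eq_zero _ hl, ofPair_eq_zero _ hl, ofPair_eq_zero _ hl]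
    exact ((congrArg₂ _ (LinearMap.rTensor_zero _) (LinearMap.lTensor_zero _)).trans
      (add_zero _)).symm

/-- the Chern character is a well-defined ring homomorphism
`K₀(g) → H^*(g,A)`: it is additive on direct sums (so factors through the Grothendieck
group relations), multiplicative on tensor products, and its components are cocycles. -/
theorem chern_character_ring_hom [Algebra ℚ A]
    [Module.Finite A W] [Module.Free A W] [Module.Finite A W'] [Module.Free A W']
    (D : LRConnection L W) (D' : LRConnection L W')
    (S : LRConnection L (W × W'))
    (hS : ∀ (z : g) (w : W) (w' : W'), S.conn z (w, w') = (D.conn z w, D'.conn z w'))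
    (T : LRConnection L (W ⊗[A] W'))
    (hT : ∀ (z : g) (w : W) (w' : W'),
      T.conn z (w ⊗ₜ[A] w') = D.conn z w ⊗ₜ[A] w' + w ⊗ₜ[A] D'.conn z w')
    (R : (Fin 2 → g) → (W →ₗ[A] W)) (R' : (Fin 2 → g) → (W' →ₗ[A] W'))
    (RS : (Fin 2 → g) → (W × W' →ₗ[A] W × W'))
    (RT : (Fin 2 → g) → (W ⊗[A] W' →ₗ[A] W ⊗[A] W'))
    (hR : ∀ (u : Fin 2 → g) (w : W), R u w = curvK D (u 0) (u 1) w)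
    (hR' : ∀ (u : Fin 2 → g) (w' : W'), R' u w' = curvK D' (u 0) (u 1) w')
    (hRS : ∀ (u : Fin 2 → g) (z : W × W'), RS u z = curvK S (u 0) (u 1) z)
    (hRT : ∀ (u : Fin 2 → g) (z : W ⊗[A] W'), RT u z = curvK T (u 0) (u 1) z) :
    (∀ (n : ℕ) (v : Fin (2 * n) → g), chC RS n v = chC R n v + chC R' n v) ∧
    (∀ (n : ℕ) (v : Fin (2 * n) → g),
        chC RT n v =
          ∑ i ∈ (Finset.range (n + 1)).attach,
            wedge (chC R i.1) (chC R' (n - i.1)) (fun a b => a * b)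
              (recast (by have := Finset.mem_range.mp i.2; omega) v)) ∧
    (∀ (n : ℕ) (v : Fin (2 * n + 3) → g),
        lrD (anchorConnection L) (chC R (n + 1)) v = 0) := by
  refine ⟨fun n v => ?_, fun n v => ?_, fun n v => ?_⟩
  · have h : ∀ u, RS u = (R u).prodMap (R' u) := fun u => LinearMap.ext fun z => by
      simp [hRS, hR, hR', curvK_apply, hS]
    rw [chC, powC_prodMap h, LinearMap.trace_prodMap', smul_add]
    rfl
  · rw [chC, powC_eq_pow, trace_pow_tensor (isHomogeneous_ofPair (B := Module.End A W) R)
      (ofPair_tensor (curvature_tensor hT hR hR' hRT)), Finset.smul_sum,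
      ← Finset.sum_attach]
    refine Finset.sum_congr rfl fun i _ => ?_
    have hi : i.1 ≤ n := Nat.lt_succ_iff.1 (Finset.mem_range.1 i.2)
    set c : ℚ := ((i.1.factorial : ℚ)⁻¹) * (((n - i.1).factorial : ℚ)⁻¹) with hc
    rw [wedge_eq_shuffleSum (F := fun a b => c •
        (LinearMap.trace A W ((ofPair (B := Module.End A W) R ^ i.1) a) *
          LinearMap.trace A W' ((ofPair (B := Module.End A W') R' ^ (n - i.1)) b)))
      (fun u w => by rw [chC, chC, powC_eq_pow, powC_eq_pow, smul_mul_smul_comm])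
      (fun a b ha => by
        rw [(isHomogeneous_ofPair (B := Module.End A W) R).pow _ a ha, map_zero, zero_mul,
          smul_zero])]
    refine Eq.trans ?_ (map_shuffleSum (DistribSMul.toAddMonoidHom A c) _ _)
    rw [ofFn_recast, DistribSMul.toAddMonoidHom_apply, ← Nat.cast_smul_eq_nsmul ℚ,
      smul_smul]
    congr 1
    rw [hc, Nat.cast_choose ℚ hi]
    have := n.factorial_ne_zero
    field_simp
  · let t : Module.End A W →+ A := (DistribSMul.toAddMonoidHom A ((n + 1).factorial : ℚ)⁻¹).comp
      (LinearMap.trace A W).toAddMonoidHom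
    have ht : ∀ x φ, t (adHom D x φ) = (L.anchor x).toAddMonoidHom (t φ) := fun x φ =>
      (congrArg _ (trace_adHom D x φ)).trans (map_rat_smul (L.anchor x).toAddMonoidHom _ _).symm
    have hch : chC R (n + 1) = fun u : Fin (2 * n + 1 + 1) → g =>
        mapAdd t (ofPair (B := Module.End A W) R ^ (n + 1)) (List.ofFn u) := funext fun u => by
      rw [chC, powC_eq_pow]; rfl
    have hd := diff_mapAdd t ht (ofPair (B := Module.End A W) R ^ (n + 1))
    rw [diff_pow_eq_zero (adHom_mul D) (bianchi hR)] at hd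
    have hl := lrD_anchor_ofFn (L := L) (((isAlt_curvature hR).pow (n + 1)).mapAdd t) v
    rw [hch]
    refine hl.trans ((congrFun hd _).trans (map_zero t))
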